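/- arXiv:1810.08171 — 2 statements merged into one kernel-verified Lean document; each statement's English description precedes it below -/
import Mathlib

section
/- Let F be a finite field, let γ ∈ (0, 1/4), and let n, d be positive integers with d ≤ n/γ. Let U, V ∈ F^{n×d} be independent random matrices whose entries are i.i.d. uniform on F, and let S ⊆ {1,…,n} × {1,…,n} be a set of index pairs with |S| < γ²d². Then for every x ∈ F^{S}, Pr[(UVᵀ)|_S = x] ≥ (1 − γ⁵d⁵ / |F|^{(1−2γ)d}) · |F|^{−|S|}. -/
open Finset Matrix
open scoped Classical

namespace Aux

lemma fiber {V X : Type} [Fintype V] [DecidableEq V] [Fintype X] (v : V) (T : Finset (V → X))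
    (hT : ∀ w ∈ T, ∀ y, Function.update w v y ∈ T) (Q : (V → X) → X → Prop)
    (hQ : ∀ w y z, Q (Function.update w v z) y ↔ Q w y) :
    Fintype.card X * (T.filter (fun w => Q w (w v))).card
      = ∑ w ∈ T, (Finset.univ.filter (Q w)).card := by
  have h1 : ∑ w ∈ T, (Finset.univ.filter (Q w)).card
      = ((T ×ˢ (Finset.univ : Finset X)).filter (fun p => Q p.1 p.2)).card := by
    rw [Finset.card_filter, Finset.sum_product]
    simp only [Finset.card_filter]
  have h2 : Fintype.card X * (T.filter (fun w => Q w (w v))).card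
      = ((T.filter (fun w => Q w (w v))) ×ˢ (Finset.univ : Finset X)).card := by
    rw [Finset.card_product, mul_comm]; rfl
  rw [h1, h2]
  refine Finset.card_bij' (fun p _ => (Function.update p.1 v p.2, p.1 v))
    (fun p _ => (Function.update p.1 v p.2, p.1 v)) ?_ ?_ ?_ ?_
  · rintro ⟨w, y⟩ h
    simp only [Finset.mem_product, Finset.mem_filter, Finset.mem_univ, and_true] at h ⊢
    exact ⟨hT _ h.1 _, (hQ _ _ _).2 h.2⟩
  · rintro ⟨w, y⟩ h
    simp only [Finset.mem_product, Finset.mem_filter, Finset.mem_univ, and_true] at h ⊢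
    refine ⟨hT _ h.1 _, (hQ _ _ _).2 ?_⟩
    simpa using h.2
  · rintro ⟨w, y⟩ h
    simp
  · rintro ⟨w, y⟩ h
    simp

variable {F : Type} [Field F] [Fintype F] {d : ℕ}

lemma card_sol {ι : Type} [Fintype ι] (f : ι → Fin d → F) (hf : LinearIndependent F f)
    (c : ι → F) :
    (Fintype.card F) ^ (Fintype.card ι) *
      (Finset.univ.filter (fun y : Fin d → F => ∀ u, f u ⬝ᵥ y = c u)).card
      = (Fintype.card F) ^ d := by
  let L := (Matrix.of f).mulVecLin
  have hL : Function.Surjective L := by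
    rw [← LinearMap.range_eq_top]
    apply Submodule.eq_top_of_finrank_eq
    have : (Matrix.of f).rank = Fintype.card ι := LinearIndependent.rank_matrix hf
    rw [Module.finrank_fintype_fun_eq_card, ← this]; rfl
  have key : ∀ c' : ι → F, (Finset.univ.filter (fun y => L y = c')).card
      = (Finset.univ.filter (fun y => L y = c)).card := by
    intro c'
    exact AddMonoidHom.card_fiber_eq_of_mem_range L.toAddMonoidHom (hL c') (hL c)
  have h1 : (Finset.univ : Finset (Fin d → F)).card
      = ∑ c' : ι → F, (Finset.univ.filter (fun y => L y = c')).card :=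
    Finset.card_eq_sum_card_fiberwise (fun _ _ => Finset.mem_coe.2 (Finset.mem_univ _))
  simp only [key, Finset.sum_const, Finset.card_univ, Fintype.card_fun, Fintype.card_fin,
    smul_eq_mul] at h1
  rw [h1]
  congr 3
  ext y
  exact funext_iff.symm

lemma card_span {V : Type} (w : V → Fin d → F) (J : Finset V) :
    (Finset.univ.filter (fun y : Fin d → F => y ∈ Submodule.span F (w '' (J : Set V)))).card
      ≤ (Fintype.card F) ^ J.card := by
  have h1 : (Finset.univ.filter (fun y : Fin d → F =>
      y ∈ Submodule.span F (w '' (J : Set V)))).card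
      = Fintype.card (Submodule.span F (w '' (J : Set V))) := by
    rw [Fintype.card_subtype]
  rw [h1, Module.card_eq_pow_finrank (K := F)]
  apply Nat.pow_le_pow_right Fintype.card_pos
  have h2 : w '' (J : Set V) = ((J.image w : Finset (Fin d → F)) : Set (Fin d → F)) := by simp
  rw [h2]
  exact (finrank_span_finset_le_card _).trans Finset.card_image_le

variable {V : Type} [Fintype V] [DecidableEq V]

lemma image_update (w : V → Fin d → F) {v : V} {J : Finset V} (hv : v ∉ J) (z : Fin d → F) :
    Function.update w v z '' (J : Set V) = w '' (J : Set V) := by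
  apply Set.image_congr
  intro a ha
  rw [Function.update_of_ne]
  rintro rfl
  exact hv ha

lemma indep_update (w : V → Fin d → F) {v : V} {J : Finset V} (hv : v ∉ J) (z : Fin d → F) :
    LinearIndepOn F (Function.update w v z) (J : Set V) ↔ LinearIndepOn F w (J : Set V) := by
  apply linearIndepOn_congr
  intro a ha
  rw [Function.update_of_ne]
  rintro rfl
  exact hv ha

lemma lemA (v : V) (T : Finset (V → Fin d → F))
    (hT : ∀ w ∈ T, ∀ y, Function.update w v y ∈ T) (N : Finset V) (hv : v ∉ N) (c : V → F)
    (hind : ∀ w ∈ T, LinearIndepOn F w (N : Set V)) :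
    Fintype.card F ^ N.card * (T.filter (fun w => ∀ u ∈ N, w u ⬝ᵥ w v = c u)).card = T.card := by
  have h := fiber v T hT (fun w y => ∀ u ∈ N, w u ⬝ᵥ y = c u) (by
    intro w y z
    refine forall₂_congr fun u hu => ?_
    rw [Function.update_of_ne]
    rintro rfl
    exact hv hu)
  have hq : 0 < Fintype.card (Fin d → F) := Fintype.card_pos
  apply Nat.eq_of_mul_eq_mul_left hq
  have h' : Fintype.card (Fin d → F) *
      (T.filter (fun w => ∀ u ∈ N, w u ⬝ᵥ w v = c u)).card
      = ∑ w ∈ T, (Finset.univ.filter (fun y : Fin d → F => ∀ u ∈ N, w u ⬝ᵥ y = c u)).card := by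
    convert h
  rw [mul_left_comm, h', Finset.mul_sum]
  have : ∀ w ∈ T, Fintype.card F ^ N.card *
      (Finset.univ.filter (fun y : Fin d → F => ∀ u ∈ N, w u ⬝ᵥ y = c u)).card
      = Fintype.card (Fin d → F) := by
    intro w hw
    have := card_sol (fun i : (N : Set V) => w i) (hind w hw) (fun i => c i)
    simp only [Fintype.card_fun, Fintype.card_fin]
    rw [← this]
    simp
  rw [Finset.sum_congr rfl this]
  simp [mul_comm]

lemma lemB (v : V) (T : Finset (V → Fin d → F))
    (hT : ∀ w ∈ T, ∀ y, Function.update w v y ∈ T) (J : Finset V) (hv : v ∉ J) :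
    Fintype.card F ^ d *
      (T.filter (fun w => w v ∈ Submodule.span F (w '' (J : Set V)))).card
      ≤ T.card * Fintype.card F ^ J.card := by
  have h := fiber v T hT (fun w y => y ∈ Submodule.span F (w '' (J : Set V))) (by
    intro w y z
    rw [image_update w hv])
  simp only [Fintype.card_fun, Fintype.card_fin] at h
  rw [h]
  refine (Finset.sum_le_card_nsmul _ _ _ (fun w _ => card_span w J)).trans ?_
  simp

/-- The inductive invariant. -/
def P (d : ℕ) (A : V → V → Prop) (c : V → V → F) (k δ : ℝ) (W : Finset V) (e : ℕ) : Prop :=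
  ∃ G : Finset (V → Fin d → F),
    (∀ w ∈ G, ∀ u ∈ W, ∀ v ∈ W, A u v → w u ⬝ᵥ w v = c u v) ∧
    (∀ w ∈ G, ∀ v, v ∉ W → ∀ y, Function.update w v y ∈ G) ∧
    ((G.card : ℝ) * (Fintype.card F : ℝ) ^ e ≤ Fintype.card (V → Fin d → F)) ∧
    ((1 - e * δ) * Fintype.card (V → Fin d → F) ≤ (G.card : ℝ) * (Fintype.card F : ℝ) ^ e) ∧
    (∀ I ⊆ W, (I.card : ℝ) ≤ k →
      ((G.filter (fun w => ¬ LinearIndepOn F w (I : Set V))).card : ℝ) * (Fintype.card F : ℝ) ^ e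
        ≤ I.card * δ * Fintype.card (V → Fin d → F))

lemma P_empty (A : V → V → Prop) (c : V → V → F) (k δ : ℝ) : P d A c k δ ∅ 0 := by
  refine ⟨Finset.univ, by simp, by simp, by simp, by simp, ?_⟩
  intro I hI _
  have : I = ∅ := Finset.subset_empty.1 hI
  subst this
  simp

lemma P_step (A : V → V → Prop) (hA : ∀ u, ¬ A u u) (hsymm : ∀ u v, A u v → A v u)
    (c : V → V → F) (hc : ∀ u v, c u v = c v u) (k δ : ℝ)
    (hδ : ∀ a b : ℕ, (a : ℝ) ≤ k → (b : ℝ) ≤ k →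
      (Fintype.card F : ℝ) ^ (a + b) ≤ δ * (Fintype.card F : ℝ) ^ d)
    (W : Finset V) (e : ℕ) (v : V) (hv : v ∉ W) (hN : ((W.filter (fun u => A u v)).card : ℝ) ≤ k)
    (h : P d A c k δ W e) : P d A c k δ (insert v W) (e + (W.filter (fun u => A u v)).card) := by
  obtain ⟨G, h1, h2, h3, h4, h5⟩ := h
  set N := W.filter (fun u => A u v) with hNdef
  have hvN : v ∉ N := fun hh => hv (Finset.mem_filter.1 hh).1
  have hNW : N ⊆ W := Finset.filter_subset _ _
  set q : ℝ := (Fintype.card F : ℝ) with hq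
  have hq0 : 0 < q := by rw [hq]; exact_mod_cast Fintype.card_pos
  set M : ℝ := (Fintype.card (V → Fin d → F) : ℝ) with hM
  have hM0 : 0 ≤ M := by rw [hM]; positivity
  let G1 := G.filter (fun w => LinearIndepOn F w (N : Set V))
  let G' := G1.filter (fun w => ∀ u ∈ N, w u ⬝ᵥ w v = c u v)
  have hG1inv : ∀ w ∈ G1, ∀ y, Function.update w v y ∈ G1 := by
    intro w hw y
    simp only [G1, Finset.mem_filter] at hw ⊢
    exact ⟨h2 w hw.1 v hv y, (indep_update w hvN y).2 hw.2⟩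
  have hG' : q ^ N.card * (G'.card : ℝ) = G1.card := by
    have := lemA v G1 hG1inv N hvN (fun u => c u v) (fun w hw => (Finset.mem_filter.1 hw).2)
    rw [hq]; exact_mod_cast this
  have hG1le : (G1.card : ℝ) ≤ G.card := by exact_mod_cast Finset.card_filter_le _ _
  have hsplit : (G1.card : ℝ) + ((G.filter (fun w => ¬ LinearIndepOn F w (N : Set V))).card : ℝ)
      = G.card := by
    exact_mod_cast Finset.card_filter_add_card_filter_not (s := G)
      (fun w => LinearIndepOn F w (N : Set V))
  have hNI := h5 N hNW hN
  -- dependent sets inside `W`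
  have hdepW : ∀ I ⊆ W, (I.card : ℝ) ≤ k →
      ((G'.filter (fun w => ¬ LinearIndepOn F w (I : Set V))).card : ℝ) * q ^ (e + N.card)
        ≤ I.card * δ * M := by
    intro I hI hIk
    have hvI : v ∉ I := fun hh => hv (hI hh)
    have hA' := lemA v (G1.filter (fun w => ¬ LinearIndepOn F w (I : Set V))) (by
      intro w hw y
      rw [Finset.mem_filter] at hw ⊢
      exact ⟨hG1inv w hw.1 y, fun hh => hw.2 ((indep_update w hvI y).1 hh)⟩) N hvN
      (fun u => c u v) (fun w hw => (Finset.mem_filter.1 (Finset.mem_filter.1 hw).1).2)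
    rw [Finset.filter_comm] at hA'
    have hA'' : q ^ N.card * ((G'.filter (fun w => ¬ LinearIndepOn F w (I : Set V))).card : ℝ)
        = ((G1.filter (fun w => ¬ LinearIndepOn F w (I : Set V))).card : ℝ) := by
      rw [hq]; exact_mod_cast hA'
    have hle : ((G1.filter (fun w => ¬ LinearIndepOn F w (I : Set V))).card : ℝ)
        ≤ ((G.filter (fun w => ¬ LinearIndepOn F w (I : Set V))).card : ℝ) := by
      exact_mod_cast Finset.card_le_card (Finset.filter_subset_filter _ (Finset.filter_subset _ _))
    refine le_trans ?_ (h5 I hI hIk)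
    calc _ = (q ^ N.card * ((G'.filter (fun w => ¬ LinearIndepOn F w (I : Set V))).card : ℝ))
          * q ^ e := by rw [pow_add]; ring
      _ ≤ _ := by rw [hA'']; gcongr
  refine ⟨G', ?_, ?_, ?_, ?_, ?_⟩
  · intro w hw u hu u' hu' ha
    simp only [G', G1, Finset.mem_filter] at hw
    obtain ⟨⟨hwG, _⟩, hw2⟩ := hw
    rw [Finset.mem_insert] at hu hu'
    rcases hu with rfl | hu <;> rcases hu' with rfl | hu'
    · exact absurd ha (hA _)
    · rw [dotProduct_comm, hc]
      exact hw2 u' (Finset.mem_filter.2 ⟨hu', hsymm _ _ ha⟩)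
    · exact hw2 u (Finset.mem_filter.2 ⟨hu, ha⟩)
    · exact h1 w hwG u hu u' hu' ha
  · intro w hw u hu y
    rw [Finset.mem_insert, not_or] at hu
    have huN : u ∉ N := fun hh => hu.2 (hNW hh)
    simp only [G', G1, Finset.mem_filter] at hw ⊢
    refine ⟨⟨h2 w hw.1.1 u hu.2 y, (indep_update w huN y).2 hw.1.2⟩, ?_⟩
    intro a ha
    have hau : a ≠ u := by
      rintro rfl
      exact huN ha
    rw [Function.update_of_ne hau, Function.update_of_ne (Ne.symm hu.1)]
    exact hw.2 a ha
  · calc (G'.card : ℝ) * q ^ (e + N.card) = (q ^ N.card * (G'.card : ℝ)) * q ^ e := by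
          rw [pow_add]; ring
      _ ≤ G.card * q ^ e := by rw [hG']; gcongr
      _ ≤ M := h3
  · have : (G'.card : ℝ) * q ^ (e + N.card) = (q ^ N.card * (G'.card : ℝ)) * q ^ e := by
          rw [pow_add]; ring
    rw [this, hG']
    have h6 : (G1.card : ℝ) = G.card -
      ((G.filter (fun w => ¬ LinearIndepOn F w (N : Set V))).card : ℝ) := by linarith
    rw [h6, sub_mul]
    push_cast
    linarith
  · intro I hI hIk
    by_cases hvI : v ∈ I
    · obtain ⟨J, hvJ, rfl⟩ : ∃ J, v ∉ J ∧ insert v J = I :=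
        ⟨I.erase v, Finset.notMem_erase _ _, Finset.insert_erase hvI⟩
      have hJW : J ⊆ W := by
        intro a ha
        have := hI (Finset.mem_insert_of_mem ha)
        rcases Finset.mem_insert.1 this with rfl | h'
        · exact absurd ha hvJ
        · exact h'
      rw [Finset.card_insert_of_notMem hvJ] at hIk ⊢
      rw [Nat.cast_add, Nat.cast_one] at hIk ⊢
      have hJk : (J.card : ℝ) ≤ k := by linarith
      have hsub : G'.filter (fun w => ¬ LinearIndepOn F w ((insert v J : Finset V) : Set V))
          ⊆ G'.filter (fun w => ¬ LinearIndepOn F w (J : Set V)) ∪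
            G.filter (fun w => w v ∈ Submodule.span F (w '' (J : Set V))) := by
        intro w hw
        rw [Finset.mem_filter] at hw
        rw [Finset.mem_union, Finset.mem_filter (s := G'), Finset.mem_filter (s := G)]
        by_contra hcon
        rw [not_or] at hcon
        apply hw.2
        rw [Finset.coe_insert, linearIndepOn_insert (by simpa using hvJ)]
        refine ⟨?_, fun hh => hcon.2 ⟨?_, hh⟩⟩
        · by_contra h'
          exact hcon.1 ⟨hw.1, h'⟩
        · exact (Finset.mem_filter.1 (Finset.mem_filter.1 hw.1).1).1
      have hcard : ((G'.filter (fun w =>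
          ¬ LinearIndepOn F w ((insert v J : Finset V) : Set V))).card : ℝ)
          ≤ ((G'.filter (fun w => ¬ LinearIndepOn F w (J : Set V))).card : ℝ) +
            ((G.filter (fun w => w v ∈ Submodule.span F (w '' (J : Set V)))).card : ℝ) := by
        exact_mod_cast (Finset.card_le_card hsub).trans (Finset.card_union_le _ _)
      have hB : q ^ d * ((G.filter (fun w => w v ∈ Submodule.span F (w '' (J : Set V)))).card : ℝ)
          ≤ G.card * q ^ J.card := by
        have := lemB v G (fun w hw y => h2 w hw v hv y) J hvJ
        rw [hq]; exact_mod_cast this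
      have hB2 : ((G.filter (fun w => w v ∈ Submodule.span F (w '' (J : Set V)))).card : ℝ)
          * q ^ (e + N.card) ≤ δ * M := by
        have hqd : 0 < q ^ d := by positivity
        refine le_of_mul_le_mul_left ?_ hqd
        calc _ = (q ^ d * ((G.filter (fun w =>
                w v ∈ Submodule.span F (w '' (J : Set V)))).card : ℝ)) * q ^ (e + N.card) := by ring
          _ ≤ (G.card * q ^ J.card) * q ^ (e + N.card) := by gcongr
          _ = (G.card * q ^ e) * q ^ (J.card + N.card) := by rw [pow_add, pow_add]; ring
          _ ≤ M * (δ * q ^ d) := mul_le_mul h3 (hδ _ _ hJk hN) (by positivity) hM0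
          _ = _ := by ring
      have := hdepW J hJW hJk
      have hqe : 0 ≤ q ^ (e + N.card) := by positivity
      refine (mul_le_mul_of_nonneg_right hcard hqe).trans ?_
      calc _ = (((G'.filter (fun w => ¬ LinearIndepOn F w (J : Set V))).card : ℝ) +
            ((G.filter (fun w => w v ∈ Submodule.span F (w '' (J : Set V)))).card : ℝ))
              * q ^ (e + N.card) := rfl
        _ ≤ _ := by linarith
    · refine hdepW I (fun a ha => ?_) hIk
      rcases Finset.mem_insert.1 (hI ha) with rfl | h'
      · exact absurd ha hvI
      · exact h'

/-- adjacency of rows and columns -/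
def adj {n : ℕ} (S : Finset (Fin n × Fin n)) : Fin n ⊕ Fin n → Fin n ⊕ Fin n → Prop
  | Sum.inl i, Sum.inr j => (i, j) ∈ S
  | Sum.inr j, Sum.inl i => (i, j) ∈ S
  | _, _ => False

/-- targets -/
def tgt {n : ℕ} (x : Fin n × Fin n → F) : Fin n ⊕ Fin n → Fin n ⊕ Fin n → F
  | Sum.inl i, Sum.inr j => x (i, j)
  | Sum.inr j, Sum.inl i => x (i, j)
  | _, _ => 0

/-- edges inside a vertex set -/
noncomputable def edg {n : ℕ} (S : Finset (Fin n × Fin n)) (W : Finset (Fin n ⊕ Fin n)) :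
    Finset (Fin n × Fin n) :=
  S.filter (fun p => Sum.inl p.1 ∈ W ∧ Sum.inr p.2 ∈ W)

lemma edg_insert {n : ℕ} (S : Finset (Fin n × Fin n)) (W : Finset (Fin n ⊕ Fin n))
    (v : Fin n ⊕ Fin n) (hv : v ∉ W) :
    (edg S (insert v W)).card = (edg S W).card + (W.filter (fun u => adj S u v)).card := by
  have hsub : edg S W ⊆ edg S (insert v W) := by
    intro p hp
    simp only [edg, Finset.mem_filter, Finset.mem_insert] at hp ⊢
    tauto
  rw [← Finset.card_sdiff_add_card_eq_card hsub, add_comm]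
  congr 1
  cases v with
  | inl i =>
    refine Finset.card_bij (fun p _ => Sum.inr p.2) ?_ ?_ ?_
    · rintro ⟨a, b⟩ h
      simp only [edg, Finset.mem_sdiff, Finset.mem_filter, Finset.mem_insert, Sum.inl.injEq,
        reduceCtorEq, false_or] at h ⊢
      have : a = i := by tauto
      subst this
      exact ⟨h.1.2.2, h.1.1⟩
    · rintro ⟨a, b⟩ h ⟨a', b'⟩ h' hh
      simp only [edg, Finset.mem_sdiff, Finset.mem_filter, Finset.mem_insert, Sum.inl.injEq,
        reduceCtorEq, false_or] at h h'
      have h1 : a = i := by tauto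
      have h2 : a' = i := by tauto
      simp only [Sum.inr.injEq] at hh
      simp [h1, h2, hh]
    · rintro (j | j) h
      · exact ((Finset.mem_filter.1 h).2).elim
      · obtain ⟨ha, hb⟩ := Finset.mem_filter.1 h
        have hb' : (i, j) ∈ S := hb
        refine ⟨(i, j), ?_, rfl⟩
        simp [edg, ha, hb', hv]
  | inr i =>
    refine Finset.card_bij (fun p _ => Sum.inl p.1) ?_ ?_ ?_
    · rintro ⟨a, b⟩ h
      simp only [edg, Finset.mem_sdiff, Finset.mem_filter, Finset.mem_insert, Sum.inr.injEq,
        reduceCtorEq, false_or] at h ⊢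
      have : b = i := by tauto
      subst this
      exact ⟨h.1.2.1, h.1.1⟩
    · rintro ⟨a, b⟩ h ⟨a', b'⟩ h' hh
      simp only [edg, Finset.mem_sdiff, Finset.mem_filter, Finset.mem_insert, Sum.inr.injEq,
        reduceCtorEq, false_or] at h h'
      have h1 : b = i := by tauto
      have h2 : b' = i := by tauto
      simp only [Sum.inl.injEq] at hh
      simp [h1, h2, hh]
    · rintro (j | j) h
      · obtain ⟨ha, hb⟩ := Finset.mem_filter.1 h
        have hb' : (j, i) ∈ S := hb
        refine ⟨(j, i), ?_, rfl⟩
        simp [edg, ha, hb', hv]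
      · exact ((Finset.mem_filter.1 h).2).elim

/-- A vertex set in which all degrees exceed `k` spans at least `k ^ 2` edges. -/
lemma exists_low {n : ℕ} (S : Finset (Fin n × Fin n)) (k : ℝ) (hk : 0 ≤ k)
    (hS : (S.card : ℝ) < k ^ 2) (W : Finset (Fin n ⊕ Fin n)) (hW : W.Nonempty) :
    ∃ v ∈ W, ((W.filter (fun u => adj S u v)).card : ℝ) ≤ k := by
  by_contra! hcon
  have hne : ∀ v ∈ W, ∃ u ∈ W, adj S u v := by
    intro v hv
    have h1 : (0 : ℝ) < ((W.filter (fun u => adj S u v)).card : ℝ) := lt_of_le_of_lt hk (hcon v hv)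
    have h2 : 0 < (W.filter (fun u => adj S u v)).card := by exact_mod_cast h1
    obtain ⟨u, hu⟩ := Finset.card_pos.1 h2
    exact ⟨u, (Finset.mem_filter.1 hu).1, (Finset.mem_filter.1 hu).2⟩
  obtain ⟨i, hi⟩ : ∃ i : Fin n, Sum.inl i ∈ W := by
    obtain ⟨v, hv⟩ := hW
    cases v with
    | inl i => exact ⟨i, hv⟩
    | inr j =>
      obtain ⟨u, hu, hadj⟩ := hne _ hv
      cases u with
      | inl i => exact ⟨i, hu⟩
      | inr i => simp [adj] at hadj
  set C : Finset (Fin n) := Finset.univ.filter (fun j => Sum.inr j ∈ W ∧ (i, j) ∈ S) with hC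
  have hCk : k < (C.card : ℝ) := by
    refine (hcon _ hi).trans_le ?_
    have : W.filter (fun u => adj S u (Sum.inl i)) ⊆ C.image Sum.inr := by
      rintro (a | a) h
      · exact ((Finset.mem_filter.1 h).2).elim
      · obtain ⟨ha, hb⟩ := Finset.mem_filter.1 h
        have hb' : (i, a) ∈ S := hb
        simp [hC, ha, hb']
    exact_mod_cast (Finset.card_le_card this).trans Finset.card_image_le
  have hcol : ∀ j ∈ C, k ≤ ((S.filter (fun p => p.2 = j)).card : ℝ) := by
    intro j hj
    have hjW : Sum.inr j ∈ W := by simp [hC] at hj; exact hj.1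
    refine (hcon _ hjW).le.trans ?_
    have : W.filter (fun u => adj S u (Sum.inr j)) ⊆
        (S.filter (fun p => p.2 = j)).image (fun p => Sum.inl p.1) := by
      rintro (a | a) h
      · simpa [adj] using (Finset.mem_filter.1 h).2
      · exact ((Finset.mem_filter.1 h).2).elim
    exact_mod_cast (Finset.card_le_card this).trans Finset.card_image_le
  have hsum : ∑ j ∈ C, (S.filter (fun p => p.2 = j)).card ≤ S.card := by
    rw [← Finset.card_biUnion]
    · exact Finset.card_le_card (Finset.biUnion_subset.2 fun _ _ => Finset.filter_subset _ _)
    · intro a _ b _ hab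
      rw [Function.onFun, Finset.disjoint_filter]
      rintro p _ h1 h2
      exact hab (h1.symm.trans h2)
  have hsum' : (∑ j ∈ C, ((S.filter (fun p => p.2 = j)).card : ℝ)) ≤ S.card := by
    exact_mod_cast hsum
  have h3 : (C.card : ℝ) * k ≤ ∑ j ∈ C, ((S.filter (fun p => p.2 = j)).card : ℝ) := by
    have := Finset.card_nsmul_le_sum C _ k hcol
    simpa using this
  nlinarith

lemma P_all {n : ℕ} (S : Finset (Fin n × Fin n)) (x : Fin n × Fin n → F) (k δ : ℝ) (hk : 0 ≤ k)
    (hS : (S.card : ℝ) < k ^ 2)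
    (hδ : ∀ a b : ℕ, (a : ℝ) ≤ k → (b : ℝ) ≤ k →
      (Fintype.card F : ℝ) ^ (a + b) ≤ δ * (Fintype.card F : ℝ) ^ d) :
    ∀ (m : ℕ) (W : Finset (Fin n ⊕ Fin n)), W.card = m →
      P d (adj S) (tgt x) k δ W (edg S W).card := by
  intro m
  induction m with
  | zero =>
    intro W hW
    rw [Finset.card_eq_zero] at hW
    subst hW
    have : (edg S ∅).card = 0 := by simp [edg]
    rw [this]
    exact P_empty _ _ _ _
  | succ m ih =>
    intro W hW
    have hWne : W.Nonempty := Finset.card_pos.1 (by omega)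
    obtain ⟨v, hv, hvk⟩ := exists_low S k hk hS W hWne
    obtain ⟨W', hvW', rfl⟩ : ∃ W', v ∉ W' ∧ insert v W' = W :=
      ⟨W.erase v, Finset.notMem_erase _ _, Finset.insert_erase hv⟩
    rw [edg_insert S W' v hvW']
    rw [Finset.card_insert_of_notMem hvW'] at hW
    refine P_step _ ?_ ?_ _ ?_ k δ hδ W' _ v hvW' (le_trans ?_ hvk) (ih W' (by omega))
    · rintro (u | u) <;> simp [adj]
    · rintro (u | u) (u' | u') <;> simp [adj]
    · rintro (u | u) (u' | u') <;> simp [tgt]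
    · exact_mod_cast Finset.card_le_card
        (Finset.filter_subset_filter _ (Finset.subset_insert _ _))

end Aux

/-- For i.i.d. uniform `U, V ∈ F^{n×d}` and any observed set `S` of fewer than `γ²d²` entries,
every observation `x` of `(UVᵀ)|_S` has probability at least
`(1 - γ⁵d⁵/|F|^{(1-2γ)d})·|F|^{-|S|}`.  Probability is (favorable count)/(total count). -/
theorem stmt5 {F : Type} [Field F] [Fintype F]
    {γ : ℝ} (hγ0 : 0 < γ) (hγ : γ < 1 / 4)
    {n d : ℕ} (hn : 0 < n) (hd : 0 < d) (hdn : (d : ℝ) ≤ (n : ℝ) / γ)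
    (S : Finset (Fin n × Fin n)) (hS : (S.card : ℝ) < γ ^ 2 * (d : ℝ) ^ 2)
    (x : Fin n × Fin n → F) :
    (1 - γ ^ 5 * (d : ℝ) ^ 5 / (Fintype.card F : ℝ) ^ ((1 - 2 * γ) * (d : ℝ))) *
        ((Fintype.card F : ℝ) ^ S.card)⁻¹ ≤
      ((Finset.univ.filter fun UV :
          Matrix (Fin n) (Fin d) F × Matrix (Fin n) (Fin d) F =>
            ∀ p ∈ S, (UV.1 * UV.2ᵀ) p.1 p.2 = x p).card : ℝ) /
        (Fintype.card (Matrix (Fin n) (Fin d) F × Matrix (Fin n) (Fin d) F) : ℝ) := by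
  set q : ℝ := (Fintype.card F : ℝ) with hq
  have hq1 : 1 ≤ q := by rw [hq]; exact_mod_cast Fintype.card_pos
  have hq0 : 0 < q := by linarith
  have hd' : (0 : ℝ) < d := by exact_mod_cast hd
  set k : ℝ := γ * d with hk
  have hk0 : 0 < k := by positivity
  set δ : ℝ := (q ^ ((1 - 2 * γ) * (d : ℝ)))⁻¹ with hδ
  have hδ0 : 0 < δ := by positivity
  have hSk : (S.card : ℝ) < k ^ 2 := by rw [hk, mul_pow]; exact hS
  have hP := Aux.P_all (d := d) S x k δ hk0.le hSk (by
    intro a b ha hb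
    rw [← hq, hδ, ← Real.rpow_neg hq0.le, ← Real.rpow_natCast, ← Real.rpow_natCast,
      ← Real.rpow_add hq0]
    apply Real.rpow_le_rpow_of_exponent_le hq1
    push_cast
    rw [hk] at ha hb
    linarith) _ Finset.univ rfl
  have hedg : Aux.edg S Finset.univ = S := by simp [Aux.edg]
  rw [hedg] at hP
  obtain ⟨G, h1, -, -, h4, -⟩ := hP
  have hcardle : G.card ≤ (Finset.univ.filter fun UV :
          Matrix (Fin n) (Fin d) F × Matrix (Fin n) (Fin d) F =>
            ∀ p ∈ S, (UV.1 * UV.2ᵀ) p.1 p.2 = x p).card := by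
    refine Finset.card_le_card_of_injOn
      (fun w => (Matrix.of (fun i => w (Sum.inl i)), Matrix.of (fun i => w (Sum.inr i)))) ?_ ?_
    · intro w hw
      simp only [Finset.coe_filter, Finset.mem_univ, true_and, Set.mem_ofPred_eq]
      rintro ⟨i, j⟩ hp
      exact h1 w hw (Sum.inl i) (Finset.mem_univ _) (Sum.inr j) (Finset.mem_univ _) hp
    · intro w _ w' _ h
      simp only [Prod.mk.injEq, EmbeddingLike.apply_eq_iff_eq] at h
      funext v
      cases v with
      | inl i => exact congrFun h.1 i
      | inr i => exact congrFun h.2 i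
  have hM : Fintype.card (Fin n ⊕ Fin n → Fin d → F)
      = Fintype.card (Matrix (Fin n) (Fin d) F × Matrix (Fin n) (Fin d) F) :=
    Fintype.card_congr (Equiv.sumArrowEquivProdArrow (Fin n) (Fin n) (Fin d → F))
  rw [hM] at h4
  have hM0 : (0 : ℝ) < (Fintype.card (Matrix (Fin n) (Fin d) F × Matrix (Fin n) (Fin d) F) : ℝ) := by
    exact_mod_cast Fintype.card_pos
  have hSk5 : (S.card : ℝ) ≤ γ ^ 5 * (d : ℝ) ^ 5 := by
    rw [← mul_pow, ← hk]
    rcases Nat.eq_zero_or_pos S.card with h0 | h0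
    · rw [h0]; push_cast; positivity
    · have h0' : (1 : ℝ) ≤ S.card := by exact_mod_cast h0
      have hk1 : 1 ≤ k := by nlinarith
      exact hSk.le.trans (pow_le_pow_right₀ hk1 (by norm_num))
  have hcardle' : (G.card : ℝ) ≤ ((Finset.univ.filter fun UV :
          Matrix (Fin n) (Fin d) F × Matrix (Fin n) (Fin d) F =>
            ∀ p ∈ S, (UV.1 * UV.2ᵀ) p.1 p.2 = x p).card : ℝ) := by exact_mod_cast hcardle
  have hqS : 0 < q ^ S.card := by positivity
  rw [le_div_iff₀ hM0]
  refine le_trans ?_ hcardle'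
  rw [div_eq_mul_inv, ← hδ, mul_right_comm, ← div_eq_mul_inv, div_le_iff₀ hqS]
  refine le_trans ?_ h4
  have : (S.card : ℝ) * δ ≤ γ ^ 5 * (d : ℝ) ^ 5 * δ := by gcongr
  exact mul_le_mul_of_nonneg_right (by linarith) hM0.le
end

section
/- Let F be a finite field, let γ ∈ (0, 1/4), and let n, d be positive integers with d ≤ n/γ. Let U, V ∈ F^{n×d} be independent random matrices with i.i.d. entries uniform on F, and let W ∈ F^{n×n} be a random matrix with i.i.d. entries uniform on F. For any set S ⊆ {1,…,n} × {1,…,n} with |S| < γ²d², the total variation distance between the distribution of (UVᵀ)|_S and the distribution of W|_S (which is uniform on F^{S}) is at most γ⁵d⁵ / |F|^{(1−2γ)d}. -/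
open Finset Matrix
open scoped Classical

/-- Number of points satisfying a predicate (instance-free). -/
noncomputable def auxCnt {α : Type*} (P : α → Prop) : ℕ := Nat.card {x // P x}

lemma auxCnt_eq {α : Type*} [Fintype α] (P : α → Prop) [DecidablePred P] :
    auxCnt P = (univ.filter P).card := by
  rw [auxCnt, Nat.card_eq_fintype_card, Fintype.card_subtype]

lemma auxCnt_mono {α : Type*} [Finite α] {P Q : α → Prop} (h : ∀ x, P x → Q x) :
    auxCnt P ≤ auxCnt Q :=
  Nat.card_le_card_of_injective (fun x : {x // P x} => (⟨x.1, h _ x.2⟩ : {x // Q x}))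
    (fun x y hxy => Subtype.ext (congrArg (fun z : {x // Q x} => z.1) hxy))

lemma auxCnt_or {α : Type*} [Finite α] (P Q : α → Prop) :
    auxCnt (fun x => P x ∨ Q x) ≤ auxCnt P + auxCnt Q := by
  have := Fintype.ofFinite α
  rw [auxCnt_eq, auxCnt_eq, auxCnt_eq, Finset.filter_or]
  exact Finset.card_union_le _ _

lemma auxCnt_exists {α ι : Type*} [Finite α] [Fintype ι] (P : ι → α → Prop) :
    auxCnt (fun x => ∃ i, P i x) ≤ ∑ i, auxCnt (P i) := by
  have := Fintype.ofFinite α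
  simp only [auxCnt_eq]
  refine le_trans (Finset.card_le_card ?_) Finset.card_biUnion_le
  intro x hx
  simpa using hx

lemma auxCnt_fst {α β : Type*} [Fintype α] [Fintype β] (P : α → Prop) :
    auxCnt (fun x : α × β => P x.1) = auxCnt P * Fintype.card β := by
  rw [← Nat.card_eq_fintype_card, auxCnt, auxCnt, ← Nat.card_prod]
  exact Nat.card_congr ⟨fun x => (⟨x.1.1, x.2⟩, x.1.2), fun x => ⟨(x.1.1, x.2), x.1.2⟩,
    fun x => rfl, fun x => rfl⟩

lemma auxCnt_snd {α β : Type*} [Fintype α] [Fintype β] (P : β → Prop) :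
    auxCnt (fun x : α × β => P x.2) = Fintype.card α * auxCnt P := by
  rw [← Nat.card_eq_fintype_card, auxCnt, auxCnt, ← Nat.card_prod]
  exact Nat.card_congr ⟨fun x => (x.1.1, ⟨x.1.2, x.2⟩), fun x => ⟨(x.1, x.2.1), x.2.2⟩,
    fun x => rfl, fun x => rfl⟩

/-- Slicing a count on a product by the second coordinate. -/
lemma auxCnt_slice {α β : Type*} [Fintype α] [Fintype β] (P : α → β → Prop) (Q : β → Prop) :
    auxCnt (fun x : α × β => Q x.2 ∧ P x.1 x.2) = ∑ b ∈ univ.filter Q, auxCnt (fun a => P a b) := by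
  simp only [auxCnt_eq]
  rw [← Finset.card_sigma]
  refine Finset.card_bij' (fun x _ => ⟨x.2, x.1⟩) (fun x _ => (x.2, x.1)) ?_ ?_ ?_ ?_
  · intro x hx; simpa using hx
  · intro x hx; simpa using hx
  · intro x _; rfl
  · intro x _; rfl

lemma aux_tv {Ω Y : Type*} [Fintype Ω] [Fintype Y] [Nonempty Ω] [Nonempty Y] (f : Ω → Y) (G : Ω → Prop)
    (h : ∀ y, auxCnt (fun x => G x ∧ f x = y) * Fintype.card Y ≤ Fintype.card Ω) :
    (1 / 2 : ℝ) * ∑ y : Y, |(auxCnt (fun x => f x = y) : ℝ) / (Fintype.card Ω : ℝ)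
      - ((Fintype.card Y : ℝ))⁻¹| ≤ (auxCnt (fun x => ¬ G x) : ℝ) / (Fintype.card Ω : ℝ) := by
  simp only [auxCnt_eq] at h ⊢
  have hΩ : (0 : ℝ) < Fintype.card Ω := by exact_mod_cast Fintype.card_pos
  have hY : (0 : ℝ) < Fintype.card Y := by exact_mod_cast Fintype.card_pos
  have key : ∀ y, |((univ.filter fun x => f x = y).card : ℝ) / (Fintype.card Ω : ℝ)
      - ((Fintype.card Y : ℝ))⁻¹| ≤ ((univ.filter fun x => f x = y).card : ℝ) / (Fintype.card Ω : ℝ)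
      + ((Fintype.card Y : ℝ))⁻¹
      - 2 * (((univ.filter fun x => G x ∧ f x = y).card : ℝ) / (Fintype.card Ω : ℝ)) := by
    intro y
    have h1 : ((univ.filter fun x => G x ∧ f x = y).card : ℝ) / (Fintype.card Ω : ℝ)
        ≤ ((Fintype.card Y : ℝ))⁻¹ := by
      rw [div_le_iff₀ hΩ, inv_mul_eq_div, le_div_iff₀ hY]
      exact_mod_cast h y
    have h2 : ((univ.filter fun x => G x ∧ f x = y).card : ℝ) / (Fintype.card Ω : ℝ)
        ≤ ((univ.filter fun x => f x = y).card : ℝ) / (Fintype.card Ω : ℝ) := by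
      gcongr
      intro hx
      tauto
    rw [abs_le]
    constructor <;> linarith
  have s1 : ∑ y : Y, ((univ.filter fun x => f x = y).card : ℝ) = Fintype.card Ω := by
    rw [← Finset.card_univ, Finset.card_eq_sum_card_fiberwise (f := f) (t := univ) (by simp)]
    push_cast; rfl
  have s2 : ∑ y : Y, ((univ.filter fun x => G x ∧ f x = y).card : ℝ)
      = ((univ.filter fun x => G x).card : ℝ) := by
    rw [Finset.card_eq_sum_card_fiberwise (f := f) (t := univ) (by simp)]
    push_cast
    simp [Finset.filter_filter]
  have s3 : ((univ.filter fun x => G x).card : ℝ) + ((univ.filter fun x => ¬ G x).card : ℝ)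
      = Fintype.card Ω := by
    exact_mod_cast Finset.card_filter_add_card_filter_not (s := (univ : Finset Ω)) G
  calc _ ≤ (1 / 2 : ℝ) * ∑ y : Y, (((univ.filter fun x => f x = y).card : ℝ) / (Fintype.card Ω : ℝ)
      + ((Fintype.card Y : ℝ))⁻¹
      - 2 * (((univ.filter fun x => G x ∧ f x = y).card : ℝ) / (Fintype.card Ω : ℝ))) := by
        gcongr with y
        exact key y
    _ = _ := by
        rw [Finset.sum_sub_distrib, Finset.sum_add_distrib, ← Finset.mul_sum, ← Finset.sum_div,
          ← Finset.sum_div, s1, s2]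
        simp only [sum_const, card_univ, nsmul_eq_mul]
        rw [mul_inv_cancel₀ hY.ne', ← s3]
        have : ((univ.filter fun x => G x).card : ℝ) + ((univ.filter fun x => ¬ G x).card : ℝ) ≠ 0 := by
          rw [s3]; exact hΩ.ne'
        field_simp
        ring

lemma aux_fibre {M N : Type*} [AddCommGroup M] [AddCommGroup N] [Fintype M] [Fintype N]
    (φ : M →+ N) (hφ : Function.Surjective φ) (y : N) :
    auxCnt (fun x => φ x = y) * Fintype.card N = Fintype.card M := by
  rw [auxCnt_eq]
  rw [← Finset.card_univ (α := M),
    Finset.card_eq_sum_card_fiberwise (f := φ) (s := univ) (t := univ) (by simp)]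
  rw [Finset.sum_congr rfl (fun z _ => AddMonoidHom.card_fiber_eq_of_mem_range φ (y := y)
    (Set.mem_range.2 (hφ z)) (Set.mem_range.2 (hφ y)))]
  simp [mul_comm]

lemma aux_dep {F : Type*} [Field F] [Fintype F] {K : Type*} [AddCommGroup K] [Module F K]
    [Fintype K] {ι : Type*} [Fintype ι] :
    auxCnt (fun v : ι → K => ¬ LinearIndependent F v) * Fintype.card K
      ≤ (Fintype.card F ^ Fintype.card ι - 1) * Fintype.card K ^ Fintype.card ι := by
  have hsub : auxCnt (fun v : ι → K => ¬ LinearIndependent F v) ≤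
      ∑ c : {c : ι → F // c ≠ 0}, auxCnt (fun v : ι → K => ∑ i, c.1 i • v i = 0) := by
    refine (auxCnt_mono ?_).trans (auxCnt_exists _)
    intro v hv
    rw [Fintype.not_linearIndependent_iff] at hv
    obtain ⟨g, hg, i, hi⟩ := hv
    exact ⟨⟨g, fun h => hi (by simp [h])⟩, hg⟩
  calc _ ≤ (∑ c : {c : ι → F // c ≠ 0}, auxCnt (fun v : ι → K => ∑ i, c.1 i • v i = 0))
          * Fintype.card K := Nat.mul_le_mul_right _ hsub
    _ = ∑ c : {c : ι → F // c ≠ 0}, Fintype.card (ι → K) := by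
        rw [Finset.sum_mul]
        refine Finset.sum_congr rfl fun c _ => ?_
        obtain ⟨c, hc0⟩ := c
        obtain ⟨i, hi⟩ := Function.ne_iff.1 hc0
        let φ : (ι → K) →+ K :=
          { toFun := fun v => ∑ i, c i • v i
            map_zero' := by simp
            map_add' := by intro a b; simp [Finset.sum_add_distrib] }
        refine aux_fibre φ ?_ 0
        intro x
        refine ⟨Pi.single i ((c i)⁻¹ • x), ?_⟩
        change ∑ k, c k • (Pi.single i ((c i)⁻¹ • x) : ι → K) k = x
        rw [Finset.sum_eq_single i]
        · simp [smul_smul, mul_inv_cancel₀ hi]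
        · intro b _ hb; simp [hb]
        · simp
    _ = _ := by
        simp [Fintype.card_subtype_compl]

lemma aux_solve {F : Type*} [Field F] [Fintype F] {d : ℕ} {ι : Type*} [Fintype ι]
    (v : ι → Fin d → F) (hv : LinearIndependent F v) (y : ι → F) :
    auxCnt (fun u : Fin d → F => ∀ j, v j ⬝ᵥ u = y j) * Fintype.card F ^ Fintype.card ι
      = Fintype.card F ^ d := by
  have hs : Function.Surjective (Matrix.mulVecLin (Matrix.of v)) := by
    rw [← LinearMap.range_eq_top]
    apply Submodule.eq_top_of_finrank_eq
    have := LinearIndependent.rank_matrix (M := Matrix.of v) hv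
    rw [Matrix.rank] at this
    simp [this]
  have := aux_fibre (Matrix.mulVecLin (Matrix.of v)).toAddMonoidHom hs y
  simp only [Fintype.card_fun, Fintype.card_fin] at this
  rw [← this]
  congr 2
  funext u
  simp [funext_iff, Matrix.mulVec]

lemma aux_split {I K : Type*} [Fintype I] [Fintype K] (p : I → Prop)
    (P : ({i // p i} → K) → Prop) (A : I → K → Prop) :
    auxCnt (fun U : I → K => P (fun i => U i) ∧ ∀ i, ¬ p i → A i (U i))
      = auxCnt P * ∏ i : {i // ¬ p i}, auxCnt (A i) := by
  unfold auxCnt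
  rw [← Nat.card_pi, ← Nat.card_prod]
  exact Nat.card_congr
    { toFun := fun U => (⟨fun i => U.1 i, U.2.1⟩, fun i => ⟨U.1 i, U.2.2 i.1 i.2⟩)
      invFun := fun x => ⟨fun i => if h : p i then x.1.1 ⟨i, h⟩ else (x.2 ⟨i, h⟩).1, by
        refine ⟨?_, ?_⟩
        · convert x.1.2 using 1
          funext i
          simp [i.2]
        · intro i hi
          simp only [hi, dite_false]
          exact (x.2 ⟨i, hi⟩).2⟩
      left_inv := by
        intro U
        ext i
        simp
      right_inv := by
        rintro ⟨⟨a, ha⟩, b⟩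
        refine Prod.ext (Subtype.ext (funext fun i => ?_)) (funext fun i => Subtype.ext ?_)
        · simp [i.2]
        · simp [i.2] }

lemma auxCnt_true {α : Type*} [Fintype α] : auxCnt (fun _ : α => True) = Fintype.card α := by
  simp [auxCnt_eq]

lemma aux_dep' {F : Type*} [Field F] [Fintype F] {K : Type*} [AddCommGroup K] [Module F K]
    [Fintype K] {I : Type*} [Fintype I] (p : I → Prop) :
    auxCnt (fun U : I → K => ¬ LinearIndependent F (fun i : {i // p i} => U i))
      * Fintype.card K
      ≤ (Fintype.card F ^ Fintype.card {i // p i} - 1) * Fintype.card K ^ Fintype.card I := by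
  have h1 := aux_split p (fun a : {i // p i} → K => ¬ LinearIndependent F a)
    (fun _ _ => True)
  simp only [implies_true, and_true, auxCnt_true, prod_const, card_univ] at h1
  rw [h1, mul_right_comm]
  have h2 : Fintype.card I = Fintype.card {i // p i} + Fintype.card {i // ¬ p i} := by
    rw [Fintype.card_subtype_compl]
    have := Fintype.card_subtype_le p
    omega
  rw [h2, pow_add, ← mul_assoc]
  exact Nat.mul_le_mul_right _ aux_dep

/-- The good event: heavy rows of `U` are independent, and for each light row the relevant
rows of `V` are independent. -/
def auxGood {F : Type} [Field F] {n d : ℕ} (S : Finset (Fin n × Fin n)) (p : Fin n → Prop)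
    (UV : (Fin n → Fin d → F) × (Fin n → Fin d → F)) : Prop :=
  LinearIndependent F (fun i : {i // p i} => UV.1 i) ∧
    ∀ i, ¬ p i → LinearIndependent F (fun j : {j // (i, j) ∈ S} => UV.2 j)

lemma aux_bad {F : Type} [Field F] [Fintype F] {n d : ℕ} (S : Finset (Fin n × Fin n))
    (p : Fin n → Prop) :
    auxCnt (fun UV : (Fin n → Fin d → F) × (Fin n → Fin d → F) => ¬ auxGood S p UV)
        * Fintype.card F ^ d ≤
      ((Fintype.card F ^ Fintype.card {i // p i} - 1) +
        ∑ i : {i // ¬ p i}, (Fintype.card F ^ Fintype.card {j // (i.1, j) ∈ S} - 1)) *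
      ((Fintype.card F ^ d) ^ n * (Fintype.card F ^ d) ^ n) := by
  have hsub : auxCnt (fun UV : (Fin n → Fin d → F) × (Fin n → Fin d → F) => ¬ auxGood S p UV) ≤
      auxCnt (fun U : Fin n → Fin d → F => ¬ LinearIndependent F (fun i : {i // p i} => U i))
        * (Fintype.card F ^ d) ^ n +
      ∑ i : {i // ¬ p i}, (Fintype.card F ^ d) ^ n * auxCnt (fun V : Fin n → Fin d → F =>
          ¬ LinearIndependent F (fun j : {j // (i.1, j) ∈ S} => V j)) := by
    have hc : Fintype.card (Fin n → Fin d → F) = (Fintype.card F ^ d) ^ n := by simp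
    simp only [← hc, ← auxCnt_snd (α := Fin n → Fin d → F)]
    rw [← auxCnt_fst (β := Fin n → Fin d → F)]
    refine le_trans ?_ (Nat.add_le_add_left (auxCnt_exists _) _)
    refine (auxCnt_mono ?_).trans (auxCnt_or _ _)
    intro UV h
    simp only [auxGood, not_and_or, not_forall] at h
    rcases h with h | ⟨i, hi, h⟩
    · exact Or.inl h
    · exact Or.inr ⟨⟨i, hi⟩, h⟩
  refine (Nat.mul_le_mul_right _ hsub).trans ?_
  have hK : Fintype.card (Fin d → F) = Fintype.card F ^ d := by simp
  rw [add_mul, add_mul, Finset.sum_mul, Finset.sum_mul]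
  refine add_le_add ?_ (Finset.sum_le_sum fun i _ => ?_)
  · have := aux_dep' (F := F) (K := Fin d → F) p
    rw [hK, Fintype.card_fin] at this
    rw [mul_right_comm, ← mul_assoc]
    exact Nat.mul_le_mul_right _ this
  · have := aux_dep' (F := F) (K := Fin d → F) (fun j => (i.1, j) ∈ S)
    rw [hK, Fintype.card_fin] at this
    rw [mul_assoc, mul_left_comm (_ - 1)]
    refine Nat.mul_le_mul_left _ ?_
    convert this

lemma aux_count {F : Type} [Field F] [Fintype F] {n d : ℕ} (S : Finset (Fin n × Fin n))
    (p : Fin n → Prop) (y : Fin n → Fin n → F) :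
    auxCnt (fun UV : (Fin n → Fin d → F) × (Fin n → Fin d → F) =>
      auxGood S p UV ∧ ∀ i j, (i, j) ∈ S → UV.1 i ⬝ᵥ UV.2 j = y i j) *
      ((∏ i : {i // ¬ p i}, Fintype.card F ^ Fintype.card {j // (i.1, j) ∈ S}) *
       (∏ j : Fin n, Fintype.card F ^ Fintype.card {i : {i // p i} // (i.1, j) ∈ S})) ≤
      (Fintype.card F ^ d) ^ n * (Fintype.card F ^ d) ^ n := by
  set q := Fintype.card F
  obtain ⟨A, hA⟩ : ∃ A : (Fin n → Fin d → F) → Fin n → (Fin d → F) → Prop, A = fun V i u =>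
    ∀ j : {j // (i, j) ∈ S}, V j ⬝ᵥ u = y i j := ⟨_, rfl⟩
  obtain ⟨B, hB⟩ : ∃ B : ({i // p i} → Fin d → F) → Fin n → (Fin d → F) → Prop, B = fun a j v =>
    ∀ i : {i : {i // p i} // (i.1, j) ∈ S}, a i.1 ⬝ᵥ v = y i.1 j := ⟨_, rfl⟩
  obtain ⟨P, hP⟩ : ∃ P : (Fin n → Fin d → F) → ({i // p i} → Fin d → F) → Prop, P = fun V a =>
    LinearIndependent F a ∧ ∀ j, B a j (V j) := ⟨_, rfl⟩
  obtain ⟨good, hgood⟩ : ∃ good : (Fin n → Fin d → F) → Prop, good = fun V =>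
    ∀ i, ¬ p i → LinearIndependent F (fun j : {j // (i, j) ∈ S} => V j) := ⟨_, rfl⟩
  -- slice by `V`
  have h0 : auxCnt (fun UV : (Fin n → Fin d → F) × (Fin n → Fin d → F) =>
      auxGood S p UV ∧ ∀ i j, (i, j) ∈ S → UV.1 i ⬝ᵥ UV.2 j = y i j) ≤
      ∑ V ∈ univ.filter good, auxCnt (fun U : Fin n → Fin d → F =>
        P V (fun i => U i) ∧ ∀ i, ¬ p i → A V i (U i)) := by
    rw [← auxCnt_slice (fun (U : Fin n → Fin d → F) V =>
        P V (fun i => U i) ∧ ∀ i, ¬ p i → A V i (U i)) good]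
    refine auxCnt_mono ?_
    rintro ⟨U, V⟩ h
    simp only [hP, hgood, hA, hB]
    refine ⟨h.1.2, ⟨h.1.1, fun j i => h.2 _ _ i.2⟩, fun i hi j => ?_⟩
    rw [dotProduct_comm]
    exact h.2 _ _ j.2
  have h1 : ∀ V ∈ univ.filter good, auxCnt (fun U : Fin n → Fin d → F =>
        P V (fun i => U i) ∧ ∀ i, ¬ p i → A V i (U i)) *
        (∏ i : {i // ¬ p i}, q ^ Fintype.card {j // (i.1, j) ∈ S}) =
        auxCnt (P V) * ∏ i : {i // ¬ p i}, q ^ d := by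
    intro V hV
    rw [aux_split, mul_assoc, ← Finset.prod_mul_distrib]
    congr 1
    refine Finset.prod_congr rfl fun i _ => ?_
    have hV' := (Finset.mem_filter.1 hV).2
    rw [hgood] at hV'
    rw [hA]
    exact aux_solve (fun j : {j // (i.1, j) ∈ S} => V j) (hV' i.1 i.2) (fun j => y i.1 j)
  have h2 : ∑ V ∈ univ.filter good, auxCnt (P V) ≤
      ∑ a ∈ univ.filter (fun a : {i // p i} → Fin d → F => LinearIndependent F a),
        ∏ j, auxCnt (B a j) := by
    rw [← auxCnt_slice (fun a V => P V a) good]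
    have e : ∀ a : {i // p i} → Fin d → F, ∏ j, auxCnt (B a j) =
        auxCnt (fun V : Fin n → Fin d → F => ∀ j, B a j (V j)) := by
      intro a
      unfold auxCnt
      rw [← Nat.card_pi]
      exact Nat.card_congr ⟨fun x => ⟨fun j => (x j).1, fun j => (x j).2⟩,
        fun x j => ⟨x.1 j, x.2 j⟩, fun x => rfl, fun x => rfl⟩
    simp only [e]
    rw [← auxCnt_slice (fun (V : Fin n → Fin d → F) a => ∀ j, B a j (V j))
      (fun a => LinearIndependent F a)]
    refine Nat.card_le_card_of_injective (fun x => ⟨(x.1.2, x.1.1), ?_⟩) ?_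
    · have h := x.2.2
      have hP' : ∀ V a, P V a → LinearIndependent F a ∧ ∀ j, B a j (V j) := by
        intro V a h; rwa [hP] at h
      exact hP' _ _ h
    · rintro ⟨⟨U, V⟩, _⟩ ⟨⟨U', V'⟩, _⟩ h
      simp only [Subtype.mk.injEq, Prod.mk.injEq] at h ⊢
      exact ⟨h.2, h.1⟩
  have h3 : ∀ a ∈ univ.filter (fun a : {i // p i} → Fin d → F => LinearIndependent F a),
      (∏ j, auxCnt (B a j)) *
        (∏ j : Fin n, q ^ Fintype.card {i : {i // p i} // (i.1, j) ∈ S}) = (q ^ d) ^ n := by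
    intro a ha
    have hn : (q ^ d) ^ n = ∏ j : Fin n, q ^ d := by simp
    rw [← Finset.prod_mul_distrib, hn]
    refine Finset.prod_congr rfl fun j _ => ?_
    rw [hB]
    exact aux_solve (fun i : {i : {i // p i} // (i.1, j) ∈ S} => a i.1)
      ((Finset.mem_filter.1 ha).2.comp _ Subtype.val_injective) (fun i => y i.1 j)
  have hcard : (q ^ d) ^ n = (q ^ d) ^ Fintype.card {i // p i} * ∏ i : {i // ¬ p i}, q ^ d := by
    have h2 : n = Fintype.card {i // p i} + Fintype.card {i // ¬ p i} := by
      rw [Fintype.card_subtype_compl, Fintype.card_fin]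
      have := Fintype.card_subtype_le p
      rw [Fintype.card_fin] at this
      omega
    rw [prod_const, card_univ, ← pow_add, ← h2]
  have hind : (univ.filter (fun a : {i // p i} → Fin d → F => LinearIndependent F a)).card
      ≤ (q ^ d) ^ Fintype.card {i // p i} := by
    refine (Finset.card_le_univ _).trans ?_
    simp [q]
  calc _ ≤ (∑ V ∈ univ.filter good, auxCnt (fun U : Fin n → Fin d → F =>
        P V (fun i => U i) ∧ ∀ i, ¬ p i → A V i (U i))) *
      ((∏ i : {i // ¬ p i}, q ^ Fintype.card {j // (i.1, j) ∈ S}) *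
       (∏ j : Fin n, q ^ Fintype.card {i : {i // p i} // (i.1, j) ∈ S})) :=
        Nat.mul_le_mul_right _ h0
    _ = (∑ V ∈ univ.filter good, auxCnt (P V)) *
        ((∏ i : {i // ¬ p i}, q ^ d) *
         (∏ j : Fin n, q ^ Fintype.card {i : {i // p i} // (i.1, j) ∈ S})) := by
        rw [← mul_assoc, Finset.sum_mul, Finset.sum_congr rfl h1, ← Finset.sum_mul, mul_assoc]
    _ ≤ (∑ a ∈ univ.filter (fun a : {i // p i} → Fin d → F => LinearIndependent F a),
        ∏ j, auxCnt (B a j)) * ((∏ i : {i // ¬ p i}, q ^ d) *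
         (∏ j : Fin n, q ^ Fintype.card {i : {i // p i} // (i.1, j) ∈ S})) :=
        Nat.mul_le_mul_right _ h2
    _ = (∑ a ∈ univ.filter (fun a : {i // p i} → Fin d → F => LinearIndependent F a),
        (q ^ d) ^ n) * ∏ i : {i // ¬ p i}, q ^ d := by
        rw [← Finset.sum_congr rfl h3, ← Finset.sum_mul, mul_assoc, mul_comm (∏ i : {i // ¬ p i}, q ^ d)]
    _ ≤ ((q ^ d) ^ Fintype.card {i // p i} * (q ^ d) ^ n) * ∏ i : {i // ¬ p i}, q ^ d := by
        rw [Finset.sum_const, smul_eq_mul]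
        exact Nat.mul_le_mul_right _ (Nat.mul_le_mul_right _ hind)
    _ = _ := by
        rw [mul_right_comm, ← hcard]

lemma aux_S {n : ℕ} (S : Finset (Fin n × Fin n)) (p : Fin n → Prop) :
    S.card = ∑ i : {i // p i}, Fintype.card {j // (i.1, j) ∈ S}
      + ∑ i : {i // ¬ p i}, Fintype.card {j // (i.1, j) ∈ S} := by
  have : S.card = ∑ i, Fintype.card {j // (i, j) ∈ S} := by
    rw [← Fintype.card_sigma, ← Fintype.card_coe]
    refine Fintype.card_congr ⟨fun x => ⟨x.1.1, x.1.2, x.2⟩, fun x => ⟨(x.1, x.2.1), x.2.2⟩, ?_, ?_⟩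
    · intro x; rfl
    · intro x; rfl
  rw [this]
  exact (Fintype.sum_subtype_add_sum_subtype p _).symm

lemma aux_S' {n : ℕ} (S : Finset (Fin n × Fin n)) (p : Fin n → Prop) :
    ∑ j : Fin n, Fintype.card {i : {i // p i} // (i.1, j) ∈ S} =
    ∑ i : {i // p i}, Fintype.card {j // (i.1, j) ∈ S} := by
  rw [← Fintype.card_sigma, ← Fintype.card_sigma]
  refine Fintype.card_congr ⟨fun x => ⟨x.2.1, x.1, x.2.2⟩, fun x => ⟨x.2.1, x.1, x.2.2⟩, ?_, ?_⟩
  · intro x; rfl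
  · intro x; rfl

/-- The total variation distance between the distribution of `(UVᵀ)|_S` (for i.i.d. uniform
`U, V ∈ F^{n×d}`) and the uniform distribution on `F^S` is at most `γ⁵d⁵/|F|^{(1-2γ)d}`,
whenever `|S| < γ²d²`.  Distributions are expressed by counting. -/
theorem stmt6 {F : Type} [Field F] [Fintype F]
    {γ : ℝ} (hγ0 : 0 < γ) (hγ : γ < 1 / 4)
    {n d : ℕ} (hn : 0 < n) (hd : 0 < d) (hdn : (d : ℝ) ≤ (n : ℝ) / γ)
    (S : Finset (Fin n × Fin n)) (hS : (S.card : ℝ) < γ ^ 2 * (d : ℝ) ^ 2) :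
    (1 / 2 : ℝ) * ∑ y : {p // p ∈ S} → F,
        |((Finset.univ.filter fun UV :
              Matrix (Fin n) (Fin d) F × Matrix (Fin n) (Fin d) F =>
                ∀ p : {p // p ∈ S}, (UV.1 * UV.2ᵀ) p.1.1 p.1.2 = y p).card : ℝ) /
            (Fintype.card (Matrix (Fin n) (Fin d) F × Matrix (Fin n) (Fin d) F) : ℝ) -
          ((Fintype.card F : ℝ) ^ S.card)⁻¹|
      ≤ γ ^ 5 * (d : ℝ) ^ 5 / (Fintype.card F : ℝ) ^ ((1 - 2 * γ) * (d : ℝ)) := by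
  set k : ℝ := γ * d with hk
  have hdR : (0 : ℝ) < d := by exact_mod_cast hd
  have hk0 : 0 < k := by positivity
  have hSk : (S.card : ℝ) < k ^ 2 := by rw [hk]; nlinarith [hS]
  let p : Fin n → Prop := fun i => k < (Fintype.card {j // (i, j) ∈ S} : ℝ)
  let f : Matrix (Fin n) (Fin d) F × Matrix (Fin n) (Fin d) F → ({p // p ∈ S} → F) :=
    fun UV r => (UV.1 * UV.2ᵀ) r.1.1 r.1.2
  have hcY : Fintype.card ({p // p ∈ S} → F) = Fintype.card F ^ S.card := by simp
  have hq1 : 1 ≤ Fintype.card F := Fintype.card_pos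
  have hqR : (1 : ℝ) ≤ Fintype.card F := by exact_mod_cast hq1
  have hNe : Fintype.card (Matrix (Fin n) (Fin d) F × Matrix (Fin n) (Fin d) F) =
      (Fintype.card F ^ d) ^ n * (Fintype.card F ^ d) ^ n := by
    rw [Fintype.card_prod]
    have : Fintype.card (Matrix (Fin n) (Fin d) F) = (Fintype.card F ^ d) ^ n := by
      change Fintype.card (Fin n → Fin d → F) = _
      simp
    rw [this]
  have htv := aux_tv f (auxGood S p) (by
    intro y
    have hc := aux_count (d := d) S p (fun i j => if h : (i, j) ∈ S then y ⟨(i, j), h⟩ else 0)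
    rw [Finset.prod_pow_eq_pow_sum, Finset.prod_pow_eq_pow_sum, ← pow_add, aux_S', add_comm,
      ← aux_S S p] at hc
    rw [hcY]
    rw [hNe]
    refine le_trans (Nat.mul_le_mul_right _ ?_) hc
    refine auxCnt_mono (α := (Fin n → Fin d → F) × (Fin n → Fin d → F)) ?_
    rintro UV ⟨h1, h2⟩
    refine ⟨h1, fun i j hij => ?_⟩
    rw [dif_pos hij, ← h2]
    rfl)
  rw [hcY] at htv
  push_cast at htv
  have hE : ∀ y : {p // p ∈ S} → F, (Finset.univ.filter fun UV :
              Matrix (Fin n) (Fin d) F × Matrix (Fin n) (Fin d) F =>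
                ∀ p : {p // p ∈ S}, (UV.1 * UV.2ᵀ) p.1.1 p.1.2 = y p).card =
      auxCnt fun x => f x = y := by
    intro y; rw [auxCnt_eq]; congr 1; ext UV; simp [f, funext_iff]
  simp only [hE]
  refine htv.trans ?_
  have hbad := aux_bad (F := F) (d := d) S p
  rw [← hNe] at hbad
  set N := Fintype.card (Matrix (Fin n) (Fin d) F × Matrix (Fin n) (Fin d) F) with hN
  have hNpos : (0 : ℝ) < N := by exact_mod_cast Fintype.card_pos
  set q := Fintype.card F with hq
  -- number of heavy rows
  have hT := aux_S S p
  have hmul : (Fintype.card {i // p i} : ℝ) * k ≤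
      ((∑ i : {i // p i}, Fintype.card {j // (i.1, j) ∈ S} : ℕ) : ℝ) := by
    push_cast
    rw [← nsmul_eq_mul, ← Finset.card_univ, ← Finset.sum_const]
    exact Finset.sum_le_sum fun i _ => i.2.le
  have hTR : (S.card : ℝ) = ((∑ i : {i // p i}, Fintype.card {j // (i.1, j) ∈ S} : ℕ) : ℝ)
      + ((∑ i : {i // ¬ p i}, Fintype.card {j // (i.1, j) ∈ S} : ℕ) : ℝ) := by
    rw [hT]; push_cast; rfl
  have hheavy : (Fintype.card {i // p i} : ℝ) ≤ k := by
    have : (0 : ℝ) ≤ ((∑ i : {i // ¬ p i}, Fintype.card {j // (i.1, j) ∈ S} : ℕ) : ℝ) :=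
      Nat.cast_nonneg _
    by_contra hcon
    push Not at hcon
    nlinarith
  have hpow : ∀ m : ℕ, (m : ℝ) ≤ k → ((q ^ m - 1 : ℕ) : ℝ) ≤ m * (q : ℝ) ^ (2 * k) := by
    intro m hm
    rcases Nat.eq_zero_or_pos m with rfl | hm0
    · simp
    · have h1 : ((q ^ m - 1 : ℕ) : ℝ) ≤ (q : ℝ) ^ (2 * k) := by
        calc ((q ^ m - 1 : ℕ) : ℝ) ≤ ((q ^ m : ℕ) : ℝ) := by exact_mod_cast Nat.sub_le _ _
          _ = (q : ℝ) ^ (m : ℝ) := by push_cast; rw [Real.rpow_natCast]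
          _ ≤ _ := Real.rpow_le_rpow_of_exponent_le hqR (by linarith)
      have h2 : (1 : ℝ) ≤ m := by exact_mod_cast hm0
      nlinarith [Nat.cast_nonneg (α := ℝ) (q ^ m - 1)]
  have hheavy' : Fintype.card {i // p i} ≤ ∑ i : {i // p i}, Fintype.card {j // (i.1, j) ∈ S} := by
    rw [← Finset.card_univ, Finset.card_eq_sum_ones]
    refine Finset.sum_le_sum fun i _ => ?_
    have : (0 : ℝ) < (Fintype.card {j // (i.1, j) ∈ S} : ℝ) := hk0.trans i.2
    exact_mod_cast this
  have hQ : (0 : ℝ) < (q : ℝ) ^ (2 * k) := Real.rpow_pos_of_pos (by linarith) _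
  have hsum : (((q ^ Fintype.card {i // p i} - 1) +
        ∑ i : {i // ¬ p i}, (q ^ Fintype.card {j // (i.1, j) ∈ S} - 1) : ℕ) : ℝ)
      ≤ S.card * (q : ℝ) ^ (2 * k) := by
    rw [hTR, add_mul]
    rw [Nat.cast_add]
    refine add_le_add ((hpow _ hheavy).trans ?_) ?_
    · gcongr
    · rw [Nat.cast_sum, Nat.cast_sum, Finset.sum_mul]
      exact Finset.sum_le_sum fun i _ => hpow _ (not_lt.1 i.2)
  have hbadR : (auxCnt (fun x : Matrix (Fin n) (Fin d) F × Matrix (Fin n) (Fin d) F =>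
      ¬ auxGood S p x) : ℝ) * (q : ℝ) ^ (d : ℝ) ≤ S.card * (q : ℝ) ^ (2 * k) * N := by
    rw [Real.rpow_natCast]
    refine le_trans ?_ (mul_le_mul_of_nonneg_right hsum hNpos.le)
    exact_mod_cast hbad
  have hexp : (q : ℝ) ^ ((1 - 2 * γ) * (d : ℝ)) = (q : ℝ) ^ (d : ℝ) / (q : ℝ) ^ (2 * k) := by
    rw [← Real.rpow_sub (by linarith)]
    congr 1
    rw [hk]; ring
  have hqd : (0 : ℝ) < (q : ℝ) ^ (d : ℝ) := Real.rpow_pos_of_pos (by linarith) _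
  have hcard5 : (S.card : ℝ) ≤ γ ^ 5 * (d : ℝ) ^ 5 := by
    rw [← mul_pow, ← hk]
    rcases Nat.eq_zero_or_pos S.card with h | h
    · rw [h]; simp only [Nat.cast_zero]; positivity
    · have h1 : (1 : ℝ) ≤ S.card := by exact_mod_cast h
      have h2 : 1 ≤ k := by nlinarith
      exact hSk.le.trans (pow_le_pow_right₀ h2 (by norm_num))
  rw [hexp, div_div_eq_mul_div, div_le_div_iff₀ hNpos hqd]
  refine hbadR.trans ?_
  gcongr
end
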